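/- arXiv:1505.07780 — 6 statements merged into one kernel-verified Lean document; each statement's English description precedes it below -/
import Mathlib

section
/- Let t and t' be two integers with 1 ≤ t' < t. Every pG-t-atom contains a pG-t'-atom as an induced subgraph. -/
noncomputable section

open Function

/-- A proper coloring of `G` with colors in `Fin k`. -/
def IsProperColoring {V : Type} (G : SimpleGraph V) {k : ℕ} (c : V → Fin k) : Prop :=
  ∀ u v : V, G.Adj u v → c u ≠ c v

/-- A b-`k`-coloring: a surjective proper coloring in which every color class
contains a b-vertex. -/
def IsBColoring {V : Type} (G : SimpleGraph V) {k : ℕ} (c : V → Fin k) : Prop :=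
  Function.Surjective c ∧ IsProperColoring G c ∧
    ∀ i : Fin k, ∃ v : V, c v = i ∧ ∀ j : Fin k, j ≠ i → ∃ u : V, G.Adj v u ∧ c u = j

def HasBColoring {V : Type} (G : SimpleGraph V) (k : ℕ) : Prop :=
  ∃ c : V → Fin k, IsBColoring G c

/-- The b-chromatic number `φ(G)`. -/
def bChromatic {V : Type} [Fintype V] (G : SimpleGraph V) : ℕ :=
  sSup {k | HasBColoring G k}

/-- The b-relaxed number `φ_r(G)`: the maximum of `φ(H)` over induced subgraphs `H`. -/
def bRelaxed {V : Type} [Fintype V] (G : SimpleGraph V) : ℕ :=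
  sSup {k | ∃ s : Finset V, bChromatic (G.induce (↑s : Set V)) = k}

/-- A partial Grundy `k`-coloring: a surjective proper coloring in which every
color class contains a Grundy vertex. -/
def IsPartialGrundyColoring {V : Type} (G : SimpleGraph V) {k : ℕ} (c : V → Fin k) : Prop :=
  Function.Surjective c ∧ IsProperColoring G c ∧
    ∀ i : Fin k, ∃ v : V, c v = i ∧ ∀ j : Fin k, j < i → ∃ u : V, G.Adj v u ∧ c u = j

/-- The partial Grundy number `∂Γ(G)`. -/
def partialGrundy {V : Type} [Fintype V] (G : SimpleGraph V) : ℕ :=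
  sSup {k | ∃ c : V → Fin k, IsPartialGrundyColoring G c}

/-- A pG-`t`-atom structure on a graph `A`. -/
def IsPGAtom {V : Type} (A : SimpleGraph V) (t : ℕ) : Prop :=
  ∃ (D : Fin t → Finset V) (c : Fin t → V),
    (∀ v : V, ∃! i : Fin t, v ∈ D i) ∧
    (∀ i : Fin t, c i ∈ D i) ∧
    (∀ i : Fin t, ∀ u ∈ D i, ∀ v ∈ D i, ¬ A.Adj u v) ∧
    (∀ i : Fin t, (D i).card ≤ t - (i : ℕ)) ∧
    (∀ i j : Fin t, j < i → ∃ v ∈ D j, A.Adj (c i) v)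

/-- A minimal pG-`t`-atom: no proper induced subgraph is a pG-`t`-atom. -/
def IsMinPGAtom {V : Type} [Fintype V] (A : SimpleGraph V) (t : ℕ) : Prop :=
  IsPGAtom A t ∧
    ∀ s : Finset V, s ≠ Finset.univ → ¬ IsPGAtom (A.induce (↑s : Set V)) t

/-- A b-`t`-atom structure on a graph `A`. -/
def IsBAtom {V : Type} (A : SimpleGraph V) (t : ℕ) : Prop :=
  ∃ (D : Fin t → Finset V) (c : Fin t → V),
    (∀ v : V, ∃! i : Fin t, v ∈ D i) ∧
    (∀ i : Fin t, c i ∈ D i) ∧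
    (∀ i : Fin t, ∀ u ∈ D i, ∀ v ∈ D i, ¬ A.Adj u v) ∧
    (∀ i : Fin t, (D i).card ≤ t) ∧
    (∀ i j : Fin t, i ≠ j → ∃ v ∈ D j, A.Adj (c i) v)

/-- A minimal b-`t`-atom: no proper induced subgraph is a b-`t`-atom. -/
def IsMinBAtom {V : Type} [Fintype V] (A : SimpleGraph V) (t : ℕ) : Prop :=
  IsBAtom A t ∧
    ∀ s : Finset V, s ≠ Finset.univ → ¬ IsBAtom (A.induce (↑s : Set V)) t

/-- `V(A) ∪ N(A)` for the induced subgraph of `G` on `s`. -/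
def closedNbhdSet {V : Type} (G : SimpleGraph V) (s : Set V) : Set V :=
  s ∪ {v : V | v ∉ s ∧ ∃ u ∈ s, G.Adj u v}

/-- The induced subgraph of `G` on `s` is feasible (as a b-`t`-atom) in `G`:
some b-`t`-coloring of it extends to a proper coloring of the induced subgraph
on `V(A) ∪ N(A)` using only the `t` colors. -/
def IsFeasibleIn {V : Type} (G : SimpleGraph V) (s : Finset V) (t : ℕ) : Prop :=
  ∃ c : V → Fin t,
    IsBColoring (G.induce (↑s : Set V)) (fun v => c v.1) ∧
    ∀ u v : V, u ∈ closedNbhdSet G (↑s : Set V) → v ∈ closedNbhdSet G (↑s : Set V) →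
      G.Adj u v → c u ≠ c v

/-- A b-`t`-trap vertex: an induced b-`t`-atom avoiding `v`, not feasible in `G`
but feasible in `G - v`. -/
def IsVertexBTrap {V : Type} [Fintype V] [DecidableEq V] (G : SimpleGraph V) (v : V)
    (t : ℕ) : Prop :=
  ∃ s : Finset V, v ∉ s ∧ IsBAtom (G.induce (↑s : Set V)) t ∧ ¬ IsFeasibleIn G s t ∧
    IsFeasibleIn (G.induce {u : V | u ≠ v}) (s.subtype (fun u => u ≠ v)) t

/-- A b-`t`-trap edge: an induced b-`t`-atom, not feasible in `G`
but feasible in `G - e`. -/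
def IsEdgeBTrap {V : Type} (G : SimpleGraph V) (e : Sym2 V) (t : ℕ) : Prop :=
  ∃ s : Finset V, IsBAtom (G.induce (↑s : Set V)) t ∧ ¬ IsFeasibleIn G s t ∧
    IsFeasibleIn (G.deleteEdges {e}) s t

/-- The chromatic number as a natural number (least `k` admitting a surjective
proper `k`-coloring). -/
def chromaticNum {V : Type} [Fintype V] (G : SimpleGraph V) : ℕ :=
  sInf {k | ∃ c : V → Fin k, Function.Surjective c ∧ IsProperColoring G c}

/-- `G` is b-χ-`k`-bounded: `φ(G') - χ(G') ≤ k` for every induced subgraph `G'`. -/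
def IsBChiBounded {V : Type} [Fintype V] (G : SimpleGraph V) (k : ℕ) : Prop :=
  ∀ s : Finset V,
    bChromatic (G.induce (↑s : Set V)) - chromaticNum (G.induce (↑s : Set V)) ≤ k

/-- A χ-`k`-unbounded b-atom: a b-`t`-atom (for some positive `t`) with
`φ(G) - χ(G) > k`. -/
def IsChiUnboundedBAtom {V : Type} [Fintype V] (A : SimpleGraph V) (k : ℕ) : Prop :=
  k < bChromatic A - chromaticNum A ∧ ∃ t : ℕ, 1 ≤ t ∧ IsBAtom A t

/-- A minimal χ-`k`-unbounded b-atom. -/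
def IsMinChiUnboundedBAtom {V : Type} [Fintype V] (A : SimpleGraph V) (k : ℕ) : Prop :=
  IsChiUnboundedBAtom A k ∧
    ∀ s : Finset V, s ≠ Finset.univ → ¬ IsChiUnboundedBAtom (A.induce (↑s : Set V)) k

end

/-- every pG-t-atom contains a pG-t'-atom as induced subgraph (1 ≤ t' < t). -/
theorem pGAtom_contains_smaller {V : Type} [Fintype V] (t t' : ℕ) (ht' : 1 ≤ t')
    (htt : t' < t) (A : SimpleGraph V) (hA : IsPGAtom A t) :
    ∃ s : Finset V, IsPGAtom (A.induce (↑s : Set V)) t' := by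
  classical
  obtain ⟨D, c, hpart, hc, hind, -, hadj⟩ := hA
  have hw : ∀ i j : Fin t, ∃ v ∈ D j, (j < i → A.Adj (c i) v) ∧ (i = j → v = c j) := by
    intro i j
    by_cases hji : j < i
    · obtain ⟨v, hv, hav⟩ := hadj i j hji
      exact ⟨v, hv, fun _ => hav, fun h => absurd h hji.ne'⟩
    · exact ⟨c j, hc j, fun h => absurd h hji, fun _ => rfl⟩
  choose w hwD hwadj hwc using hw
  let ι : Fin t' → Fin t := Fin.castLE htt.le
  have hι : Function.Injective ι := Fin.castLE_injective htt.le
  let E : Fin t' → Finset V := fun j => (Finset.Ici j).image fun i => w (ι i) (ι j)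
  have hED : ∀ j, ∀ v ∈ E j, v ∈ D (ι j) := by
    intro j v hv
    obtain ⟨i, -, rfl⟩ := Finset.mem_image.mp hv
    exact hwD _ _
  have hwE : ∀ i j : Fin t', j ≤ i → w (ι i) (ι j) ∈ E j := fun i j hij =>
    Finset.mem_image.mpr ⟨i, Finset.mem_Ici.mpr hij, rfl⟩
  have hcE : ∀ j, c (ι j) ∈ E j := fun j => hwc (ι j) (ι j) rfl ▸ hwE j j le_rfl
  let s : Finset V := Finset.univ.biUnion E
  have hEs : ∀ j, ∀ v ∈ E j, v ∈ (s : Set V) := fun j v hv =>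
    Finset.mem_coe.mpr (Finset.mem_biUnion.mpr ⟨j, Finset.mem_univ j, hv⟩)
  refine ⟨s, fun j => (E j).subtype (· ∈ (s : Set V)), fun j => ⟨c (ι j), hEs j _ (hcE j)⟩,
    ?_, ?_, ?_, ?_, ?_⟩
  · rintro ⟨v, hv⟩
    obtain ⟨j, -, hj⟩ := Finset.mem_biUnion.mp (Finset.mem_coe.mp hv)
    refine ⟨j, Finset.mem_subtype.mpr hj, fun k hk => hι ?_⟩
    exact (hpart v).unique (hED k v (Finset.mem_subtype.mp hk)) (hED j v hj)
  · exact fun j => Finset.mem_subtype.mpr (hcE j)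
  · intro j u hu v hv
    exact hind (ι j) u (hED j u (Finset.mem_subtype.mp hu)) v (hED j v (Finset.mem_subtype.mp hv))
  · intro j
    calc ((E j).subtype (· ∈ (s : Set V))).card ≤ (E j).card := by
          rw [Finset.card_subtype]
          exact Finset.card_filter_le _ _
      _ ≤ (Finset.Ici j).card := Finset.card_image_le
      _ = t' - j := Fin.card_Ici j
  · intro i j hji
    have hmem := hwE i j hji.le
    exact ⟨⟨w (ι i) (ι j), hEs j _ hmem⟩, Finset.mem_subtype.mpr hmem, hwadj _ _ hji⟩
end

section
/- For every graph G and every positive integer t, the partial Grundy number satisfies ∂Γ(G) ≥ t if and only if G contains an induced subgraph that is a minimal pG-t-atom. -/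
/-- Being a partial Grundy atom is invariant under graph isomorphism. -/
theorem IsPGAtom.of_iso {V W : Type} {A : SimpleGraph V} {B : SimpleGraph W} {t : ℕ}
    (e : A ≃g B) (h : IsPGAtom A t) : IsPGAtom B t := by
  obtain ⟨D, c, hpart, hc, hind, hcard, hadj⟩ := h
  have hmem : ∀ i w, w ∈ (D i).map e.toEquiv.toEmbedding ↔ e.symm w ∈ D i := fun i w =>
    Finset.mem_map_equiv
  refine ⟨fun i => (D i).map e.toEquiv.toEmbedding, fun i => e (c i), fun w => ?_, fun i => ?_,
    fun i u hu v hv => ?_, fun i => ?_, fun i j hij => ?_⟩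
  · simpa only [hmem] using hpart (e.symm w)
  · exact Finset.mem_map_of_mem _ (hc i)
  · exact fun huv => hind i _ ((hmem i u).1 hu) _ ((hmem i v).1 hv) (e.symm.map_adj_iff.2 huv)
  · simpa using hcard i
  · obtain ⟨v, hv, hcv⟩ := hadj i j hij
    exact ⟨e v, Finset.mem_map_of_mem _ hv, e.map_adj_iff.2 hcv⟩

/-- An induced subgraph of an induced subgraph is an induced subgraph. -/
def induceInduceIso {V : Type} (G : SimpleGraph V) (s : Finset V)
    (r : Finset (↑s : Set V)) :
    (G.induce (↑s : Set V)).induce (↑r : Set (↑s : Set V)) ≃g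
      G.induce (↑(r.map (Function.Embedding.subtype _)) : Set V) where
  toFun x := ⟨x.1.1, by simp⟩
  invFun x := ⟨⟨x.1, by
    obtain ⟨y, -, hy⟩ := Finset.mem_map.1 (Finset.mem_coe.1 x.2)
    exact hy ▸ y.2⟩, by
    obtain ⟨y, hyr, hy⟩ := Finset.mem_map.1 (Finset.mem_coe.1 x.2)
    have hyx : y = ⟨x.1, hy ▸ y.2⟩ := Subtype.ext hy
    exact hyx ▸ hyr⟩
  left_inv _ := rfl
  right_inv _ := rfl
  map_rel_iff' := Iff.rfl

/-- Every graph with an induced partial Grundy atom has an induced minimal one. -/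
theorem exists_isMinPGAtom_induce {V : Type} [Fintype V] {G : SimpleGraph V} {t : ℕ}
    {s : Finset V} (hs : IsPGAtom (G.induce (↑s : Set V)) t) :
    ∃ r : Finset V, IsMinPGAtom (G.induce (↑r : Set V)) t := by
  induction s using Finset.strongInduction with
  | H s ih =>
    by_cases hmin : IsMinPGAtom (G.induce (↑s : Set V)) t
    · exact ⟨s, hmin⟩
    · unfold IsMinPGAtom at hmin
      push Not at hmin
      obtain ⟨r, hr, hatom⟩ := hmin hs
      refine ih (r.map (Function.Embedding.subtype _)) ?_ (hatom.of_iso (induceInduceIso G s r))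
      refine Finset.ssubset_iff_subset_ne.2 ⟨fun x hx => ?_, fun heq => hr ?_⟩
      · obtain ⟨y, -, rfl⟩ := Finset.mem_map.1 hx
        exact y.2
      · refine Finset.eq_univ_iff_forall.2 fun x => ?_
        have hx : x.1 ∈ r.map (Function.Embedding.subtype _) := by
          rw [heq]
          exact Finset.mem_coe.1 x.2
        obtain ⟨y, hy, hyx⟩ := Finset.mem_map.1 hx
        exact Subtype.ext hyx ▸ hy

/-- The Grundy vertices of the first `t` colors together with chosen neighbors
induce a partial Grundy `t`-atom. -/
theorem IsPartialGrundyColoring.exists_isPGAtom_induce {V : Type} {G : SimpleGraph V} {k t : ℕ}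
    {c : V → Fin k} (hc : IsPartialGrundyColoring G c) (htk : t ≤ k) :
    ∃ s : Finset V, IsPGAtom (G.induce (↑s : Set V)) t := by
  classical
  obtain ⟨-, hproper, hgrundy⟩ := hc
  choose v hv n hn using fun i : Fin t => hgrundy (Fin.castLE htk i)
  let N : Fin t → Fin t → V := fun i j =>
    if h : Fin.castLE htk j < Fin.castLE htk i then n i (Fin.castLE htk j) h else v i
  have hN : ∀ i j, j < i → G.Adj (v i) (N i j) ∧ c (N i j) = Fin.castLE htk j := by
    intro i j hij
    have h : Fin.castLE htk j < Fin.castLE htk i := hij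
    simpa only [N, dif_pos h] using hn i _ h
  let D : Fin t → Finset V := fun j => insert (v j) ((Finset.Ioi j).image fun i => N i j)
  have hDc : ∀ i, ∀ x ∈ D i, c x = Fin.castLE htk i := by
    intro i x hx
    rcases Finset.mem_insert.1 hx with rfl | hx
    · exact hv i
    · obtain ⟨j, hj, rfl⟩ := Finset.mem_image.1 hx
      exact (hN j i (Finset.mem_Ioi.1 hj)).2
  have hDs : ∀ i, ∀ x ∈ D i, x ∈ (↑(Finset.univ.biUnion D) : Set V) := fun i x hx =>
    Finset.mem_coe.2 (Finset.mem_biUnion.2 ⟨i, Finset.mem_univ i, hx⟩)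
  have hvD : ∀ i, v i ∈ D i := fun i => Finset.mem_insert_self _ _
  refine ⟨Finset.univ.biUnion D, fun i => (D i).subtype _, fun i => ⟨v i, hDs i _ (hvD i)⟩,
    fun x => ?_, fun i => Finset.mem_subtype.2 (hvD i), fun i x hx y hy hxy => ?_, fun i => ?_,
    fun i j hij => ?_⟩
  · obtain ⟨i, -, hi⟩ := Finset.mem_biUnion.1 (Finset.mem_coe.1 x.2)
    refine ⟨i, Finset.mem_subtype.2 hi, fun j hj => ?_⟩
    exact Fin.castLE_injective htk
      ((hDc j _ (Finset.mem_subtype.1 hj)).symm.trans (hDc i _ hi))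
  · exact hproper x.1 y.1 hxy ((hDc i _ (Finset.mem_subtype.1 hx)).trans
      (hDc i _ (Finset.mem_subtype.1 hy)).symm)
  · have hins := Finset.card_insert_le (v i) ((Finset.Ioi i).image fun j => N j i)
    have himg := Finset.card_image_le (s := Finset.Ioi i) (f := fun j => N j i)
    have hsub : ((D i).subtype (· ∈ (↑(Finset.univ.biUnion D) : Set V))).card ≤ (D i).card := by
      rw [Finset.card_subtype]
      exact Finset.card_filter_le _ _
    rw [Fin.card_Ioi] at himg
    have := i.2
    change (D i).card ≤ _ at hins
    refine hsub.trans ?_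
    omega
  · have hmem : N i j ∈ D j :=
      Finset.mem_insert_of_mem (Finset.mem_image.2 ⟨i, Finset.mem_Ioi.2 hij, rfl⟩)
    exact ⟨⟨N i j, hDs j _ hmem⟩, Finset.mem_subtype.2 hmem, (hN i j hij).1⟩

/-- A proper coloring of the induced subgraph on `s` with colors below `t` extends to a proper
coloring of the whole graph in which each vertex outside `s` has neighbors of all smaller colors. -/
theorem exists_greedy_extension {V : Type} [Fintype V] (G : SimpleGraph V) (s : Set V) (t : ℕ)
    (f : V → ℕ) (hf : ∀ v ∈ s, f v < t) (hproper : ∀ u ∈ s, ∀ v ∈ s, G.Adj u v → f u ≠ f v) :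
    ∃ g : V → ℕ, (∀ v ∈ s, g v = f v) ∧ (∀ u v, G.Adj u v → g u ≠ g v) ∧
      ∀ v ∉ s, ∀ j < g v, ∃ u, G.Adj v u ∧ g u = j := by
  classical
  let P : (V → ℕ) → Prop := fun g =>
    (∀ v ∈ s, g v = f v) ∧ ∀ u v, G.Adj u v → g u ≠ g v
  have hne : ∃ g, P g := by
    let e := Fintype.equivFin V
    refine ⟨fun v => if v ∈ s then f v else t + e v, fun v hv => if_pos hv, fun u v huv => ?_⟩
    have hne : (e u : ℕ) ≠ e v := fun h => huv.ne (e.injective (Fin.ext h))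
    by_cases hu : u ∈ s <;> by_cases hv : v ∈ s <;> simp only [hu, hv, if_true, if_false]
    · exact hproper u hu v hv huv
    · have := hf u hu
      omega
    · have := hf v hv
      omega
    · omega
  obtain ⟨g, ⟨hgs, hg⟩, hmin⟩ : ∃ g, P g ∧ ∀ g', P g' → ∑ v, g v ≤ ∑ v, g' v :=
    let ⟨g, hg, hmin⟩ := (InvImage.wf (fun g : V → ℕ => ∑ v, g v) wellFounded_lt).has_min
      {g | P g} hne
    ⟨g, hg, fun g' hg' => not_lt.1 (hmin g' hg')⟩
  refine ⟨g, hgs, hg, fun v hv j hj => ?_⟩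
  by_contra! hno
  refine (hmin (Function.update g v j) ⟨fun w hw => ?_, fun a b hab => ?_⟩).not_gt ?_
  · rw [Function.update_of_ne (ne_of_mem_of_not_mem hw hv), hgs w hw]
  · rcases eq_or_ne a v with rfl | ha
    · rw [Function.update_self, Function.update_of_ne hab.ne']
      exact (hno b hab).symm
    · rw [Function.update_of_ne ha]
      rcases eq_or_ne b v with rfl | hb
      · rw [Function.update_self]
        exact hno a hab.symm
      · rw [Function.update_of_ne hb]
        exact hg a b hab
  · refine Finset.sum_lt_sum (fun w _ => ?_) ⟨v, Finset.mem_univ v, by simpa using hj⟩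
    rcases eq_or_ne w v with rfl | hw
    · simpa using hj.le
    · rw [Function.update_of_ne hw]

/-- A graph with an induced partial Grundy `t`-atom has a partial Grundy coloring with at least
`t` colors. -/
theorem exists_isPartialGrundyColoring_of_induce {V : Type} [Fintype V] {G : SimpleGraph V}
    {t : ℕ} (ht : 1 ≤ t) {s : Set V} (hs : IsPGAtom (G.induce s) t) :
    ∃ k, t ≤ k ∧ ∃ c : V → Fin k, IsPartialGrundyColoring G c := by
  classical
  obtain ⟨D, c, hpart, hc, hind, -, hadj⟩ := hs
  choose col hcol huniq using hpart
  have hcolD : ∀ i, ∀ x ∈ D i, col x = i := fun i x hx => (huniq x i hx).symm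
  obtain ⟨g, hgs, hg, hgrundy⟩ := exists_greedy_extension G s t
    (fun v => if h : v ∈ s then (col ⟨v, h⟩ : ℕ) else 0)
    (fun v hv => by simp only [dif_pos hv]; exact (col ⟨v, hv⟩).2)
    (fun u hu v hv huv => by
      simp only [dif_pos hu, dif_pos hv]
      intro h
      refine hind (col ⟨u, hu⟩) ⟨u, hu⟩ (hcol _) ⟨v, hv⟩ ?_ huv
      rw [Fin.ext h]
      exact hcol _)
  have hgcol : ∀ i, ∀ x ∈ D i, g x.1 = i := by
    intro i x hx
    rw [hgs x.1 x.2, dif_pos x.2, ← hcolD i x hx]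
  have hglt : ∀ v ∈ s, g v < t := fun v hv => by
    rw [hgcol _ _ (hcol ⟨v, hv⟩)]
    exact (col ⟨v, hv⟩).2
  obtain ⟨m, -, hm⟩ := Finset.exists_max_image Finset.univ g ⟨(c ⟨0, ht⟩).1, Finset.mem_univ _⟩
  have hlt : ∀ v, g v < g m + 1 := fun v => Nat.lt_succ_of_le (hm v (Finset.mem_univ v))
  have htm : t ≤ g m + 1 := by
    have h := hlt (c ⟨t - 1, by omega⟩).1
    rw [hgcol _ _ (hc _)] at h
    simp only at h
    omega
  have hwit : ∀ i < g m + 1, ∃ v, g v = i ∧ ∀ j < i, ∃ u, G.Adj v u ∧ g u = j := by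
    intro i hi
    by_cases hit : i < t
    · refine ⟨(c ⟨i, hit⟩).1, hgcol _ _ (hc _), fun j hj => ?_⟩
      obtain ⟨u, hu, hcu⟩ := hadj ⟨i, hit⟩ ⟨j, hj.trans hit⟩ hj
      exact ⟨u.1, hcu, hgcol _ _ hu⟩
    · obtain ⟨v, rfl⟩ : ∃ v, g v = i := by
        rcases (Nat.le_of_lt_succ hi).eq_or_lt with h | h
        · exact ⟨m, h.symm⟩
        · have hms : m ∉ s := fun hms => hit (h.trans (hglt m hms))
          exact (hgrundy m hms i h).imp fun _ hu => hu.2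
      exact ⟨v, rfl, hgrundy v fun hv => hit (hglt v hv)⟩
  refine ⟨g m + 1, htm, fun v => ⟨g v, hlt v⟩, fun i => ?_, fun u v huv h => ?_, fun i => ?_⟩
  · exact (hwit i i.2).imp fun _ hv => Fin.ext hv.1
  · exact hg u v huv (congrArg Fin.val h)
  · obtain ⟨v, hv, hvu⟩ := hwit i i.2
    exact ⟨v, Fin.ext hv, fun j hj => (hvu j hj).imp fun _ hu => ⟨hu.1, Fin.ext hu.2⟩⟩

/-- The number of colors of a partial Grundy coloring is at most the number of vertices. -/
theorem bddAbove_partialGrundy {V : Type} [Fintype V] (G : SimpleGraph V) :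
    BddAbove {k | ∃ c : V → Fin k, IsPartialGrundyColoring G c} := by
  refine ⟨Fintype.card V, ?_⟩
  rintro k ⟨c, hc, -⟩
  simpa using Fintype.card_le_of_surjective c hc

/-- ∂Γ(G) ≥ t iff G contains an induced minimal pG-t-atom. -/
theorem partialGrundy_ge_iff_minPGAtom {V : Type} [Fintype V] (G : SimpleGraph V) (t : ℕ)
    (ht : 1 ≤ t) :
    t ≤ partialGrundy G ↔ ∃ s : Finset V, IsMinPGAtom (G.induce (↑s : Set V)) t := by
  constructor
  · intro h
    have hne : {k | ∃ c : V → Fin k, IsPartialGrundyColoring G c}.Nonempty := by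
      by_contra hempty
      rw [partialGrundy, Set.not_nonempty_iff_eq_empty.1 hempty, csSup_empty] at h
      exact absurd (ht.trans h) (by simp)
    obtain ⟨c, hc⟩ := Nat.sSup_mem hne (bddAbove_partialGrundy G)
    obtain ⟨s, hs⟩ := hc.exists_isPGAtom_induce h
    exact exists_isMinPGAtom_induce hs
  · rintro ⟨s, hs, -⟩
    obtain ⟨k, htk, hk⟩ := exists_isPartialGrundyColoring_of_induce ht hs
    exact htk.trans (le_csSup (bddAbove_partialGrundy G) hk)
end

section
/- Let t and t' be two integers with 1 ≤ t' < t. Every b-t-atom contains a b-t'-atom as an induced subgraph. -/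
/-- every b-t-atom contains a b-t'-atom as induced subgraph (1 ≤ t' < t). -/
theorem bAtom_contains_smaller {V : Type} [Fintype V] (t t' : ℕ) (ht' : 1 ≤ t')
    (htt : t' < t) (A : SimpleGraph V) (hA : IsBAtom A t) :
    ∃ s : Finset V, IsBAtom (A.induce (↑s : Set V)) t' := by
  classical
  obtain ⟨D, c, hpart, hc, hind, -, hadj⟩ := hA
  have hex : ∀ i j : Fin t, ∃ v ∈ D j, (i = j → v = c j) ∧ (i ≠ j → A.Adj (c i) v) := by
    intro i j
    by_cases hij : i = j
    · exact ⟨c j, hc j, fun _ => rfl, fun h => absurd hij h⟩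
    · obtain ⟨v, hv, hav⟩ := hadj i j hij
      exact ⟨v, hv, fun h => absurd h hij, fun _ => hav⟩
  choose f hfD hfc hfadj using hex
  let e : Fin t' → Fin t := Fin.castLE htt.le
  have he : Function.Injective e := Fin.castLE_injective htt.le
  let s : Finset V := Finset.univ.image fun p : Fin t' × Fin t' => f (e p.1) (e p.2)
  have hs : ∀ i j, f (e i) (e j) ∈ (↑s : Set V) := fun i j =>
    Finset.mem_coe.2 (Finset.mem_image.2 ⟨(i, j), Finset.mem_univ _, rfl⟩)
  let g : Fin t' → Fin t' → (↑s : Set V) := fun i j => ⟨f (e i) (e j), hs i j⟩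
  let D' : Fin t' → Finset (↑s : Set V) := fun j => Finset.univ.image fun i => g i j
  have hg : ∀ i j, g i j ∈ D' j := fun i j => Finset.mem_image_of_mem _ (Finset.mem_univ i)
  have hD' : ∀ j, ∀ v ∈ D' j, v.1 ∈ D (e j) := by
    intro j v hv
    obtain ⟨i, -, rfl⟩ := Finset.mem_image.1 hv
    exact hfD _ _
  refine ⟨s, D', fun i => g i i, ?_, fun i => hg i i, ?_, ?_, ?_⟩
  · rintro ⟨v, hv⟩
    obtain ⟨⟨i, j⟩, -, rfl⟩ := Finset.mem_image.1 (Finset.mem_coe.1 hv)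
    exact ⟨j, hg i j, fun k hk => he ((hpart _).unique (hD' k _ hk) (hfD _ _))⟩
  · exact fun i u hu v hv => hind (e i) u (hD' i u hu) v (hD' i v hv)
  · exact fun i => Finset.card_image_le.trans (by simp)
  · intro i j hij
    refine ⟨g i j, hg i j, ?_⟩
    change A.Adj (f (e i) (e i)) (f (e i) (e j))
    rw [hfc _ _ rfl]
    exact hfadj _ _ (he.ne hij)
end

section
/- For a graph G and a positive integer t, the b-relaxed number satisfies φ_r(G) ≥ t if and only if G contains an induced subgraph that is a minimal b-t-atom. -/
/-- A b-`k`-coloring of a finite graph uses at most as many colors as there are vertices. -/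
theorem HasBColoring.le_card {V : Type} [Fintype V] {G : SimpleGraph V} {k : ℕ}
    (h : HasBColoring G k) : k ≤ Fintype.card V := by
  obtain ⟨c, hc, -⟩ := h
  simpa using Fintype.card_le_of_surjective c hc

theorem bddAbove_hasBColoring {V : Type} [Fintype V] (G : SimpleGraph V) :
    BddAbove {k | HasBColoring G k} :=
  ⟨Fintype.card V, fun _ hk => HasBColoring.le_card hk⟩

theorem HasBColoring.le_bChromatic {V : Type} [Fintype V] {G : SimpleGraph V} {k : ℕ}
    (h : HasBColoring G k) : k ≤ bChromatic G :=
  le_csSup (bddAbove_hasBColoring G) h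

/-- The maximum in the definition of the b-chromatic number is attained when it is positive. -/
theorem hasBColoring_bChromatic {V : Type} [Fintype V] {G : SimpleGraph V}
    (h : 1 ≤ bChromatic G) : HasBColoring G (bChromatic G) := by
  have hne : {k | HasBColoring G k}.Nonempty := by
    by_contra hempty
    rw [Set.not_nonempty_iff_eq_empty] at hempty
    simp [bChromatic, hempty] at h
  exact Nat.sSup_mem hne (bddAbove_hasBColoring G)

theorem bddAbove_bChromatic_induce {V : Type} [Fintype V] (G : SimpleGraph V) :
    BddAbove {k | ∃ s : Finset V, bChromatic (G.induce (↑s : Set V)) = k} :=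
  (Set.finite_range fun s : Finset V => bChromatic (G.induce (↑s : Set V))).bddAbove

/-- The classes of a b-`t`-atom are the color classes of a b-`t`-coloring. -/
theorem IsBAtom.hasBColoring {V : Type} {A : SimpleGraph V} {t : ℕ} (h : IsBAtom A t) :
    HasBColoring A t := by
  obtain ⟨D, c, hD, hc, hind, -, hadj⟩ := h
  choose f hf huniq using hD
  have hfD : ∀ i v, v ∈ D i → f v = i := fun i v hv => (huniq v i hv).symm
  refine ⟨f, fun i => ⟨c i, hfD i _ (hc i)⟩, fun u v huv he => ?_, fun i => ?_⟩
  · exact hind (f u) u (hf u) v (he ▸ hf v) huv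
  · refine ⟨c i, hfD i _ (hc i), fun j hj => ?_⟩
    obtain ⟨v, hv, hcv⟩ := hadj i j hj.symm
    exact ⟨v, hcv, hfD j v hv⟩

/-- If `A` embeds in `B` and has a b-`k`-coloring, then for every `t ≤ k` the image of `A`
contains an induced b-`t`-atom of `B`. -/
theorem HasBColoring.exists_isBAtom_induce {V W : Type} {A : SimpleGraph V} {B : SimpleGraph W}
    (f : A ↪g B) {k t : ℕ} (h : HasBColoring A k) (htk : t ≤ k) :
    ∃ s : Finset W, (↑s : Set W) ⊆ Set.range f ∧ IsBAtom (B.induce (↑s : Set W)) t := by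
  classical
  obtain ⟨c, -, hproper, hb⟩ := h
  choose b hbc hnbr using hb
  choose n hnadj hnc using hnbr
  let ι : Fin t → Fin k := Fin.castLE htk
  have hι : Function.Injective ι := Fin.castLE_injective htk
  let m : Fin t → Fin t → V := fun i j =>
    if hij : ι j = ι i then b (ι i) else n (ι i) (ι j) hij
  have hmc : ∀ i j, c (m i j) = ι j := by
    intro i j
    by_cases hij : ι j = ι i
    · simp [m, hij, hbc]
    · simp [m, hij, hnc]
  have hmadj : ∀ i j, i ≠ j → A.Adj (m i i) (m i j) := by
    intro i j hij
    have hne : ι j ≠ ι i := fun he => hij (hι he).symm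
    simpa [m, hne] using hnadj (ι i) (ι j) hne
  let s : Finset W := Finset.univ.image fun p : Fin t × Fin t => f (m p.1 p.2)
  have hms : ∀ i j, f (m i j) ∈ (↑s : Set W) := fun i j => by
    simp only [s, Finset.coe_image, Finset.coe_univ, Set.image_univ]
    exact ⟨(i, j), rfl⟩
  let x : Fin t → Fin t → (↑s : Set W) := fun i j => ⟨f (m i j), hms i j⟩
  have hx : ∀ i j i' j', x i j = x i' j' → j = j' := by
    intro i j i' j' he
    have hm : m i j = m i' j' := f.injective (congrArg Subtype.val he)
    exact hι (by rw [← hmc i j, hm, hmc])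
  refine ⟨s, ?_, fun j => Finset.univ.image fun i => x i j, fun i => x i i, ?_, ?_, ?_, ?_, ?_⟩
  · intro w hw
    simp only [s, Finset.coe_image, Finset.coe_univ, Set.image_univ] at hw
    obtain ⟨p, rfl⟩ := hw
    exact ⟨_, rfl⟩
  · rintro ⟨w, hw⟩
    have hw' := hw
    simp only [s, Finset.coe_image, Finset.coe_univ, Set.image_univ] at hw'
    obtain ⟨⟨i, j⟩, rfl⟩ := hw'
    refine ⟨j, Finset.mem_image.2 ⟨i, Finset.mem_univ _, rfl⟩, fun j' hj' => ?_⟩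
    obtain ⟨i', -, he⟩ := Finset.mem_image.1 hj'
    exact hx i' j' i j he
  · exact fun i => Finset.mem_image.2 ⟨i, Finset.mem_univ _, rfl⟩
  · intro j u hu v hv huv
    obtain ⟨i, -, rfl⟩ := Finset.mem_image.1 hu
    obtain ⟨i', -, rfl⟩ := Finset.mem_image.1 hv
    have hadj : A.Adj (m i j) (m i' j) := f.map_adj_iff.1 huv
    exact hproper _ _ hadj (by rw [hmc, hmc])
  · exact fun j => Finset.card_image_le.trans (by simp)
  · intro i j hij
    refine ⟨x i j, Finset.mem_image.2 ⟨i, Finset.mem_univ _, rfl⟩, ?_⟩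
    exact f.map_adj_iff.2 (hmadj i j hij)

/-- A graph with an induced b-`t`-atom on a finite vertex set has a minimal one. -/
theorem exists_isMinBAtom_induce {V : Type} {G : SimpleGraph V} {t : ℕ}
    (h : ∃ s : Finset V, IsBAtom (G.induce (↑s : Set V)) t) :
    ∃ s : Finset V, IsMinBAtom (G.induce (↑s : Set V)) t := by
  classical
  obtain ⟨s, hs, hmin⟩ := WellFounded.has_min (measure (Finset.card (α := V))).wf
    {s : Finset V | IsBAtom (G.induce (↑s : Set V)) t} h
  refine ⟨s, hs, fun s' hs' hatom => ?_⟩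
  obtain ⟨r, hr, hratom⟩ := hatom.hasBColoring.exists_isBAtom_induce
    ((SimpleGraph.Embedding.induce (G := G) (↑s : Set V)).comp
      (SimpleGraph.Embedding.induce (↑s' : Set (↑s : Set V)))) le_rfl
  refine hmin r hratom (Finset.card_lt_card (Finset.ssubset_iff_subset_ne.2 ⟨?_, ?_⟩))
  · intro w hw
    obtain ⟨v, rfl⟩ := hr hw
    exact v.1.2
  · rintro rfl
    refine hs' (Finset.eq_univ_iff_forall.2 fun w => ?_)
    obtain ⟨v, hv⟩ := hr w.2
    have hvw : v.1 = w := Subtype.ext hv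
    exact hvw ▸ v.2

/-- φ_r(G) ≥ t iff G contains an induced minimal b-t-atom. -/
theorem bRelaxed_ge_iff_minBAtom {V : Type} [Fintype V] (G : SimpleGraph V) (t : ℕ)
    (ht : 1 ≤ t) :
    t ≤ bRelaxed G ↔ ∃ s : Finset V, IsMinBAtom (G.induce (↑s : Set V)) t := by
  constructor
  · intro h
    have hne : {k | ∃ s : Finset V, bChromatic (G.induce (↑s : Set V)) = k}.Nonempty :=
      ⟨_, ∅, rfl⟩
    obtain ⟨s, hs⟩ := Nat.sSup_mem hne (bddAbove_bChromatic_induce G)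
    have hts : t ≤ bChromatic (G.induce (↑s : Set V)) := h.trans_eq hs.symm
    obtain ⟨r, -, hr⟩ := (hasBColoring_bChromatic (ht.trans hts)).exists_isBAtom_induce
      (SimpleGraph.Embedding.induce (↑s : Set V)) hts
    exact exists_isMinBAtom_induce ⟨r, hr⟩
  · rintro ⟨s, hs, -⟩
    exact hs.hasBColoring.le_bChromatic.trans
      (le_csSup (bddAbove_bChromatic_induce G) ⟨s, rfl⟩)
end

section
/- For every positive integer t, a minimal b-t-atom has at most t connected components. -/
/-- a minimal b-t-atom has at most t connected components. -/
theorem minBAtom_components_le {V : Type} [Fintype V] (A : SimpleGraph V) (t : ℕ)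
    (ht : 1 ≤ t) (hA : IsMinBAtom A t) :
    Nat.card A.ConnectedComponent ≤ t := by
  classical
  obtain ⟨⟨D, c, hpart, hc, hind, hcard, hadj⟩, hmin⟩ := hA
  -- The vertices reachable from some center already induce a b-atom.
  let s : Finset V := Finset.univ.filter fun v => ∃ i, A.Reachable (c i) v
  have hs : ∀ v, v ∈ (s : Set V) ↔ ∃ i, A.Reachable (c i) v := by simp [s]
  have hatom : IsBAtom (A.induce (s : Set V)) t := by
    refine ⟨fun i => (D i).subtype (· ∈ (s : Set V)),
      fun i => ⟨c i, (hs _).2 ⟨i, .rfl⟩⟩, fun v => ?_, fun i => ?_, fun i u hu v hv => ?_,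
      fun i => ?_, fun i j hij => ?_⟩
    · simpa only [Finset.mem_subtype] using hpart v
    · simpa only [Finset.mem_subtype] using hc i
    · exact hind i u (Finset.mem_subtype.1 hu) v (Finset.mem_subtype.1 hv)
    · rw [Finset.card_subtype]
      exact (Finset.card_filter_le _ _).trans (hcard i)
    · obtain ⟨v, hv, hcv⟩ := hadj i j hij
      exact ⟨⟨v, (hs v).2 ⟨i, hcv.reachable⟩⟩, Finset.mem_subtype.2 hv, hcv⟩
  have huniv : s = Finset.univ := by
    by_contra h
    exact hmin s h hatom
  have hsurj : Function.Surjective fun i : Fin t => A.connectedComponentMk (c i) := by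
    intro C
    induction C using SimpleGraph.ConnectedComponent.ind with
    | _ v =>
      obtain ⟨i, hi⟩ := (hs v).1 (by simp [huniv])
      exact ⟨i, SimpleGraph.ConnectedComponent.sound hi⟩
  simpa using Nat.card_le_card_of_surjective _ hsurj
end

section
/- For every tree T (a finite connected acyclic graph), the b-chromatic number equals the b-relaxed number: φ(T) = φ_r(T). -/
namespace BRelaxed

open SimpleGraph

variable {V : Type} {G : SimpleGraph V} {k : ℕ}

/-- `f` restricts to a b-`k`-coloring of the subgraph of `G` induced on `S`,
with `x i` a b-vertex of color `i`. -/
structure IsBColoringOn (G : SimpleGraph V) (S : Set V) (f : V → Fin k) (x : Fin k → V) :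
    Prop where
  proper : ∀ u ∈ S, ∀ v ∈ S, G.Adj u v → f u ≠ f v
  mem : ∀ i, x i ∈ S
  color : ∀ i, f (x i) = i
  exists_adj : ∀ i j, j ≠ i → ∃ u ∈ S, G.Adj (x i) u ∧ f u = j

theorem IsBColoringOn.hasBColoring {f : V → Fin k} {x : Fin k → V}
    (h : IsBColoringOn G Set.univ f x) : HasBColoring G k := by
  refine ⟨f, fun i => ⟨x i, h.color i⟩, fun u v => h.proper u trivial v trivial,
    fun i => ⟨x i, h.color i, fun j hj => ?_⟩⟩
  obtain ⟨u, -, hu⟩ := h.exists_adj i j hj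
  exact ⟨u, hu⟩

theorem exists_isBColoringOn (hk : 0 < k) {S : Set V} (h : HasBColoring (G.induce S) k) :
    ∃ (f : V → Fin k) (x : Fin k → V), IsBColoringOn G S f x := by
  classical
  obtain ⟨c, -, hc, hb⟩ := h
  choose x hx hb using hb
  refine ⟨fun v => if hv : v ∈ S then c ⟨v, hv⟩ else ⟨0, hk⟩, fun i => x i, ?_, ?_, ?_, ?_⟩
  · intro u hu v hv huv
    simpa [hu, hv] using hc ⟨u, hu⟩ ⟨v, hv⟩ huv
  · exact fun i => (x i).2
  · intro i
    simpa using hx i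
  · intro i j hj
    obtain ⟨u, hu, huj⟩ := hb i j hj
    exact ⟨u, u.2, hu, by simpa using huj⟩

/-- In an acyclic graph, two neighbors of `p` joined by a walk avoiding `p` coincide. -/
theorem eq_of_walk_avoiding (hG : G.IsAcyclic) {p u w : V} (hu : G.Adj p u) (hw : G.Adj p w)
    (q : G.Walk u w) (hq : p ∉ q.support) : u = w := by
  classical
  have hp : p ∉ (q.toPath : G.Walk u w).support := fun h =>
    hq (q.support_toPath_subset_support h)
  have h := (hG.subsingleton_path p w).elim ⟨_, q.toPath.2.cons (h := hu) hp⟩ (Path.singleton hw)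
  have h' := congrArg (fun r : G.Path p w => (r : G.Walk p w).length) h
  simp only [Walk.length_cons, Path.singleton, Walk.length_nil] at h'
  exact Walk.eq_of_length_eq_zero (p := (q.toPath : G.Walk u w)) (by lia)

/-- The vertices reachable from a neighbor `z ∈ S` of `y` with color `j` by a walk avoiding `A`. -/
def branches (G : SimpleGraph V) (S : Set V) (f : V → Fin k) (y : V) (j : Fin k) (A : Set V) :
    Set V :=
  {v | ∃ z ∈ S, G.Adj y z ∧ f z = j ∧ ∃ p : G.Walk z v, ∀ a ∈ p.support, a ∉ A}

section branches

variable {S : Set V} {f : V → Fin k} {y : V} {i j : Fin k} {A B : Set V}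

theorem notMem_of_mem_branches {v : V} (hv : v ∈ branches G S f y j A) : v ∉ A := by
  obtain ⟨z, -, -, -, p, hp⟩ := hv
  exact hp v p.end_mem_support

theorem mem_branches_of_adj {u v : V} (hu : u ∈ branches G S f y j A) (huv : G.Adj u v)
    (hv : v ∉ A) : v ∈ branches G S f y j A := by
  obtain ⟨z, hz, hyz, hj, p, hp⟩ := hu
  refine ⟨z, hz, hyz, hj, p.concat huv, fun a ha => ?_⟩
  rw [Walk.support_concat, List.mem_append, List.mem_singleton] at ha
  rcases ha with ha | rfl
  exacts [hp a ha, hv]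

theorem mem_branches_self {z : V} (hz : z ∈ S) (hyz : G.Adj y z) (hA : z ∉ A) :
    z ∈ branches G S f y (f z) A :=
  ⟨z, hz, hyz, rfl, Walk.nil, by simpa using hA⟩

theorem branches_anti (h : A ⊆ B) : branches G S f y j B ⊆ branches G S f y j A := by
  rintro v ⟨z, hz, hyz, hj, p, hp⟩
  exact ⟨z, hz, hyz, hj, p, fun a ha haA => hp a ha (h haA)⟩

theorem eq_of_mem_branches (hG : G.IsAcyclic) {v : V} (hA : y ∈ A) (hB : y ∈ B)
    (hi : v ∈ branches G S f y i A) (hj : v ∈ branches G S f y j B) : i = j := by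
  obtain ⟨z, -, hyz, rfl, p, hp⟩ := hi
  obtain ⟨w, -, hyw, rfl, q, hq⟩ := hj
  rw [eq_of_walk_avoiding hG hyz hyw (p.append q.reverse) fun h => ?_]
  rw [Walk.mem_support_append_iff, Walk.support_reverse, List.mem_reverse] at h
  exact h.elim (fun h => hp y h hA) (fun h => hq y h hB)

/-- Two vertices of `branches` adjacent to a common vertex of `A` other than `y` coincide. -/
theorem eq_of_adj_of_mem_branches (hG : G.IsAcyclic) {u w p : V} (hp : p ∈ A) (hpy : p ≠ y)
    (hu : u ∈ branches G S f y j A) (hw : w ∈ branches G S f y j A)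
    (hpu : G.Adj p u) (hpw : G.Adj p w) : u = w := by
  obtain ⟨z, -, hyz, -, q, hq⟩ := hu
  obtain ⟨z', -, hyz', -, r, hr⟩ := hw
  refine eq_of_walk_avoiding hG hpu hpw
    (q.reverse.append (Walk.cons hyz.symm (Walk.cons hyz' r))) fun h => ?_
  rw [Walk.mem_support_append_iff, Walk.support_reverse, List.mem_reverse, Walk.support_cons,
    Walk.support_cons, List.mem_cons, List.mem_cons] at h
  rcases h with h | rfl | h | h
  exacts [hq p h hp, hq _ q.start_mem_support hp, hpy h, hr p h hp]

end branches

/-- Permuting colors on `U` preserves b-colorings, provided that the colors on the boundary of `U`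
and of the b-vertices in `U` are fixed and that no b-vertex of `U` is on the boundary. -/
theorem IsBColoringOn.permute {S U : Set V} [DecidablePred (· ∈ U)] {f : V → Fin k}
    {x : Fin k → V} (h : IsBColoringOn G S f x) (π : Equiv.Perm (Fin k))
    (hbd : ∀ u ∈ U, u ∈ S → ∀ v ∈ S, v ∉ U → G.Adj u v → π (f u) = f u)
    (hfix : ∀ i, x i ∈ U → π i = i) (hnbr : ∀ i, x i ∈ U → ∀ v ∈ S, G.Adj (x i) v → v ∈ U) :
    IsBColoringOn G S (fun v => if v ∈ U then π (f v) else f v) x := by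
  refine ⟨fun u hu v hv huv => ?_, h.mem, fun i => ?_, fun i j hj => ?_⟩
  · have hne := h.proper u hu v hv huv
    by_cases hU : u ∈ U <;> by_cases hU' : v ∈ U
    · simpa [hU, hU'] using hne
    · simpa [hU, hU', hbd u hU hu v hv hU' huv] using hne
    · simpa [hU, hU', hbd v hU' hv u hu hU huv.symm] using hne
    · simpa [hU, hU'] using hne
  · by_cases hU : x i ∈ U
    · simp [hU, h.color, hfix i hU]
    · simp [hU, h.color]
  · by_cases hU : x i ∈ U
    · obtain ⟨u, hu, hiu, hj'⟩ := h.exists_adj i (π.symm j) fun e => hj <| by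
        rw [← hfix i hU, ← e, Equiv.apply_symm_apply]
      exact ⟨u, hu, hiu, by simp [hnbr i hU u hu hiu, hj']⟩
    · obtain ⟨u, hu, hiu, rfl⟩ := h.exists_adj i j hj
      refine ⟨u, hu, hiu, ?_⟩
      by_cases hu' : u ∈ U
      · simpa [hu'] using hbd u hu' hu (x i) (h.mem i) hU hiu.symm
      · simp [hu']

/-- A b-coloring extends to a vertex whose neighborhood misses a color. -/
theorem IsBColoringOn.insert_of_missing {S : Set V} {f : V → Fin k} {x : Fin k → V} {y : V}
    (h : IsBColoringOn G S f x) (hy : y ∉ S) (j : Fin k) (hj : ∀ z ∈ S, G.Adj y z → f z ≠ j) :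
    ∃ f' : V → Fin k, IsBColoringOn G (insert y S) f' x := by
  classical
  have hne : ∀ v ∈ S, v ≠ y := fun v hv e => hy (e ▸ hv)
  refine ⟨Function.update f y j, ?_, fun i => Or.inr (h.mem i), fun i => ?_, fun i l hl => ?_⟩
  · rintro u (rfl | hu) v (rfl | hv) huv
    · exact absurd rfl huv.ne
    · simpa [hne v hv] using (hj v hv huv).symm
    · simpa [hne u hu] using hj u hu huv.symm
    · simpa [hne u hu, hne v hv] using h.proper u hu v hv huv
  · simpa [hne _ (h.mem i)] using h.color i
  · obtain ⟨u, hu, hiu, hl'⟩ := h.exists_adj i l hl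
    exact ⟨u, Or.inr hu, hiu, by simpa [hne u hu] using hl'⟩

/-- A new vertex adjacent to a b-vertex of every color may receive a new color. -/
theorem IsBColoringOn.insert_new_color {S : Set V} {f : V → Fin k} {x : Fin k → V} {y : V}
    (h : IsBColoringOn G S f x) (hy : y ∉ S) (hx : ∀ i, G.Adj y (x i)) :
    ∃ (f' : V → Fin (k + 1)) (x' : Fin (k + 1) → V), IsBColoringOn G (insert y S) f' x' := by
  classical
  have hne : ∀ v ∈ S, v ≠ y := fun v hv e => hy (e ▸ hv)
  refine ⟨Function.update (fun v => (f v).castSucc) y (Fin.last k),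
    Fin.lastCases y x, ?_, fun i => ?_, fun i => ?_, fun i l hl => ?_⟩
  · rintro u (rfl | hu) v (rfl | hv) huv
    · exact absurd rfl huv.ne
    · simpa [hne v hv] using (Fin.castSucc_ne_last (f v)).symm
    · simp [hne u hu]
    · simpa [hne u hu, hne v hv] using h.proper u hu v hv huv
  · refine Fin.lastCases ?_ (fun i => ?_) i
    · simp
    · simp [h.mem i]
  · refine Fin.lastCases ?_ (fun i => ?_) i
    · simp
    · simp [hne _ (h.mem i), h.color]
  · induction i using Fin.lastCases with
    | last =>
      induction l using Fin.lastCases with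
      | last => exact absurd rfl hl
      | cast l =>
        exact ⟨x l, Or.inr (h.mem l), by simpa using hx l, by simp [hne _ (h.mem l), h.color]⟩
    | cast i =>
      induction l using Fin.lastCases with
      | last => exact ⟨y, Or.inl rfl, by simpa using (hx i).symm, by simp⟩
      | cast l =>
        obtain ⟨u, hu, hiu, hl'⟩ := h.exists_adj i l fun e => hl (by rw [e])
        exact ⟨u, Or.inr hu, by simpa using hiu, by simp [hne u hu, hl']⟩

/-- Swapping the colors `j` and `d` on the branches of color `j` at `y` frees the color `j`
for `y`. -/
theorem IsBColoringOn.insert_of_swap (hG : G.IsAcyclic) {S A : Set V} {f : V → Fin k}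
    {x : Fin k → V} {y : V} (h : IsBColoringOn G S f x) (hy : y ∉ S) (hA : y ∈ A)
    {j d : Fin k} (hjd : d ≠ j) (hstart : ∀ z ∈ S, G.Adj y z → f z = j → z ∉ A)
    (hbd : ∀ u ∈ branches G S f y j A, u ∈ S → ∀ v ∈ S, v ∈ A → G.Adj u v → f u ≠ j ∧ f u ≠ d)
    (hfix : ∀ i, x i ∈ branches G S f y j A → i ≠ j ∧ i ≠ d)
    (hnbr : ∀ i, x i ∈ branches G S f y j A → ∀ v ∈ S, G.Adj (x i) v → v ∉ A) :
    ∃ f' : V → Fin k, IsBColoringOn G (insert y S) f' x := by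
  classical
  refine (h.permute (U := branches G S f y j A) (Equiv.swap j d) ?_ ?_ ?_).insert_of_missing hy j ?_
  · intro u hu huS v hv hvU huv
    by_cases hvA : v ∈ A
    · obtain ⟨h1, h2⟩ := hbd u hu huS v hv hvA huv
      exact Equiv.swap_apply_of_ne_of_ne h1 h2
    · exact absurd (mem_branches_of_adj hu huv hvA) hvU
  · exact fun i hi => Equiv.swap_apply_of_ne_of_ne (hfix i hi).1 (hfix i hi).2
  · exact fun i hi v hv hiv => mem_branches_of_adj hi hiv (hnbr i hi v hv hiv)
  · intro z hz hyz
    by_cases hzU : z ∈ branches G S f y j A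
    · have hz' : z ∈ branches G S f y (f z) {y} := mem_branches_self hz hyz hyz.ne'
      simp [hzU, eq_of_mem_branches hG (Set.mem_singleton y) hA hz' hzU, hjd]
    · simp only [hzU, if_false]
      rintro rfl
      exact hzU (mem_branches_self hz hyz (hstart z hz hyz rfl))

theorem exists_ne_ne (hk : 3 ≤ k) (a b : Fin k) : ∃ d, d ≠ a ∧ d ≠ b := by
  have : ({a, b} : Finset (Fin k)).card < (Finset.univ : Finset (Fin k)).card := by
    rw [Finset.card_univ, Fintype.card_fin]
    exact Finset.card_le_two.trans_lt hk
  obtain ⟨d, -, hd⟩ := Finset.exists_mem_notMem_of_card_lt_card this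
  exact ⟨d, by simpa using hd⟩

/-- A b-`k`-coloring of an induced subgraph of a forest, `k ≥ 3`, yields one with `k` or `k + 1`
colors after adding a vertex. -/
theorem IsBColoringOn.insert (hG : G.IsAcyclic) (hk : 3 ≤ k) {S : Set V} {f : V → Fin k}
    {x : Fin k → V} {y : V} (h : IsBColoringOn G S f x) (hy : y ∉ S) :
    (∃ f' : V → Fin k, IsBColoringOn G (insert y S) f' x) ∨
    ∃ (f' : V → Fin (k + 1)) (x' : Fin (k + 1) → V), IsBColoringOn G (insert y S) f' x' := by
  refine or_iff_not_imp_left.2 fun hno => h.insert_new_color hy ?_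
  have hSy : ∀ v ∈ S, v ∉ ({y} : Set V) := fun v hv e => hy (e ▸ hv)
  -- for each `d`, the branches of color `j` contain a b-vertex of color `j` or `d`
  have hobst : ∀ j d, d ≠ j → ∃ i, x i ∈ branches G S f y j {y} ∧ (i = j ∨ i = d) := by
    intro j d hjd
    by_contra! hcon
    exact hno (h.insert_of_swap hG hy (Set.mem_singleton y) hjd (fun z hz _ _ => hSy z hz)
      (fun _ _ _ v hv hvA _ => absurd hvA (hSy v hv)) hcon fun _ _ v hv _ => hSy v hv)
  have hmem : ∀ j, x j ∈ branches G S f y j {y} := by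
    intro j
    by_contra hj
    have hall : ∀ d, d ≠ j → x d ∈ branches G S f y j {y} := by
      intro d hd
      obtain ⟨i, hi, rfl | rfl⟩ := hobst j d hd
      exacts [absurd hi hj, hi]
    obtain ⟨d, hd, -⟩ := exists_ne_ne hk j j
    obtain ⟨e, hej, hed⟩ := exists_ne_ne hk j d
    obtain ⟨i, hi, rfl | rfl⟩ := hobst d e hed
    · exact hd (eq_of_mem_branches hG (Set.mem_singleton y) (Set.mem_singleton y) hi (hall _ hd))
    · exact hd (eq_of_mem_branches hG (Set.mem_singleton y) (Set.mem_singleton y) hi (hall _ hej))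
  intro j
  by_contra hj
  have hA : y ∈ ({y, x j} : Set V) := Set.mem_insert _ _
  have hxA : x j ∈ ({y, x j} : Set V) := Set.mem_insert_of_mem _ rfl
  have hxy : x j ≠ y := hSy _ (h.mem j)
  obtain ⟨d, hdj, hd⟩ : ∃ d, d ≠ j ∧
      ∀ u ∈ branches G S f y j {y, x j}, G.Adj u (x j) → d ≠ f u := by
    by_cases hw : ∃ w ∈ branches G S f y j {y, x j}, G.Adj w (x j)
    · obtain ⟨w, hw, hwx⟩ := hw
      obtain ⟨d, hdj, hdw⟩ := exists_ne_ne hk j (f w)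
      refine ⟨d, hdj, fun u hu hux => ?_⟩
      rwa [eq_of_adj_of_mem_branches hG hxA hxy hu hw hux.symm hwx.symm]
    · obtain ⟨d, hdj, -⟩ := exists_ne_ne hk j j
      exact ⟨d, hdj, fun u hu hux => absurd ⟨u, hu, hux⟩ hw⟩
  have hnone : ∀ i, x i ∉ branches G S f y j {y, x j} := by
    intro i hi
    obtain rfl := eq_of_mem_branches hG (Set.mem_singleton y) hA (hmem i) hi
    exact notMem_of_mem_branches hi hxA
  refine hno (h.insert_of_swap hG hy hA hdj ?_ ?_ (fun i hi => absurd hi (hnone i))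
    fun i hi => absurd hi (hnone i))
  · rintro z hz hyz - (rfl | rfl)
    exacts [hy hz, hj hyz]
  · rintro u hu huS v hv (rfl | rfl) huv
    · exact absurd hv hy
    · exact ⟨fun e => h.proper u huS _ hv huv (e.trans (h.color j).symm), (hd u hu huv).symm⟩

theorem IsBColoringOn.exists_hasBColoring [Fintype V] (hG : G.IsAcyclic) (n : ℕ) :
    ∀ {k : ℕ}, 3 ≤ k → ∀ {S : Set V} {f : V → Fin k} {x : Fin k → V}, Sᶜ.ncard = n →
      IsBColoringOn G S f x → ∃ l, k ≤ l ∧ HasBColoring G l := by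
  induction n with
  | zero =>
    intro k _ S f x hn h
    rw [Set.ncard_eq_zero, Set.compl_empty_iff] at hn
    subst hn
    exact ⟨k, le_rfl, h.hasBColoring⟩
  | succ n ih =>
    intro k hk S f x hn h
    obtain ⟨y, hy⟩ : Sᶜ.Nonempty := by
      rw [← Set.ncard_pos]
      lia
    have hn' : (Insert.insert y S)ᶜ.ncard = n := by
      have : (Insert.insert y S)ᶜ = Sᶜ \ {y} := by
        ext v
        simp [not_or, and_comm]
      rw [this, Set.ncard_sdiff_singleton_of_mem hy, hn, Nat.add_sub_cancel]
    rcases h.insert hG hk hy with ⟨f', h'⟩ | ⟨f', x', h'⟩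
    · exact ih hk hn' h'
    · obtain ⟨l, hl, h''⟩ := ih (by lia) hn' h'
      exact ⟨l, by lia, h''⟩

theorem hasBColoring_two_of_adj (hG : G.IsAcyclic) {a b : V} (hab : G.Adj a b) :
    HasBColoring G 2 := by
  have hne := hG.coloringTwo.valid hab
  set c := hG.coloringTwo
  have hc : ∀ i : Fin 2, i = c a ∨ i = c b := by lia
  refine IsBColoringOn.hasBColoring (f := c) (x := fun i => if i = c a then a else b)
    ⟨fun u _ v _ huv => c.valid huv, fun _ => trivial, fun i => ?_, fun i j hij => ?_⟩
  · rcases hc i with rfl | rfl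
    · simp
    · simp [hne.symm]
  · rcases hc i with rfl | rfl
    · exact ⟨b, trivial, by simpa using hab, ((hc j).resolve_left hij).symm⟩
    · exact ⟨a, trivial, by simpa [hne.symm] using hab.symm, ((hc j).resolve_right hij).symm⟩

theorem hasBColoring_one_of_edgeless [Nonempty V] (h : ∀ a b, ¬ G.Adj a b) :
    HasBColoring G 1 :=
  IsBColoringOn.hasBColoring (f := fun _ => 0) (x := fun _ => Classical.arbitrary V)
    ⟨fun u _ v _ huv => absurd huv (h u v), fun _ => trivial, fun _ => (Subsingleton.elim _ _),
      fun _ _ hij => absurd (Subsingleton.elim _ _) hij⟩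

theorem exists_hasBColoring_of_induce [Fintype V] (hG : G.IsAcyclic) (hk : 0 < k) {S : Set V}
    (h : HasBColoring (G.induce S) k) : ∃ l, k ≤ l ∧ HasBColoring G l := by
  obtain ⟨f, x, h⟩ := exists_isBColoringOn hk h
  rcases le_or_gt 3 k with h3 | h3
  · exact h.exists_hasBColoring hG _ h3 rfl
  by_cases hadj : ∃ a b, G.Adj a b
  · obtain ⟨a, b, hab⟩ := hadj
    exact ⟨2, by lia, hasBColoring_two_of_adj hG hab⟩
  push Not at hadj
  have : Nonempty V := ⟨x ⟨0, hk⟩⟩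
  refine ⟨1, ?_, hasBColoring_one_of_edgeless hadj⟩
  by_contra! h1
  obtain ⟨u, -, hu, -⟩ := h.exists_adj ⟨0, hk⟩ ⟨1, h1⟩ (by simp)
  exact hadj _ _ hu

theorem HasBColoring.le_card [Fintype V] (h : HasBColoring G k) : k ≤ Fintype.card V := by
  obtain ⟨c, hc, -⟩ := h
  simpa using Fintype.card_le_of_surjective c hc

theorem bddAbove_hasBColoring [Fintype V] (G : SimpleGraph V) :
    BddAbove {k | HasBColoring G k} :=
  ⟨Fintype.card V, fun _ h => HasBColoring.le_card h⟩

theorem HasBColoring.of_iso {W : Type} {H : SimpleGraph W} (e : G ≃g H) (h : HasBColoring H k) :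
    HasBColoring G k := by
  obtain ⟨c, hs, hp, hb⟩ := h
  refine ⟨c ∘ e, hs.comp e.surjective, fun u v huv => hp _ _ (e.map_adj_iff.2 huv), fun i => ?_⟩
  obtain ⟨v, hv, hb⟩ := hb i
  refine ⟨e.symm v, by simpa using hv, fun j hj => ?_⟩
  obtain ⟨u, hu, huj⟩ := hb j hj
  exact ⟨e.symm u, e.symm.map_adj_iff.2 hu, by simpa using huj⟩

theorem bChromatic_congr {W : Type} [Fintype V] [Fintype W] {H : SimpleGraph W} (e : G ≃g H) :
    bChromatic G = bChromatic H :=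
  congrArg sSup (Set.ext fun _ => ⟨HasBColoring.of_iso e.symm, HasBColoring.of_iso e⟩)

theorem bChromatic_induce_le [Fintype V] (hG : G.IsAcyclic) (s : Set V) [Fintype s] :
    bChromatic (G.induce s) ≤ bChromatic G := by
  rcases Nat.eq_zero_or_pos (bChromatic (G.induce s)) with h | h
  · lia
  have hmem : HasBColoring (G.induce s) (bChromatic (G.induce s)) :=
    Nat.sSup_mem (Set.nonempty_iff_ne_empty.2 fun e => by simp [bChromatic, e] at h)
      (bddAbove_hasBColoring _)
  obtain ⟨l, hl, hcol⟩ := exists_hasBColoring_of_induce hG h hmem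
  exact hl.trans (le_csSup (bddAbove_hasBColoring G) hcol)

end BRelaxed

/-- for every tree T, φ(T) = φ_r(T). -/
theorem bChromatic_eq_bRelaxed_of_isTree {V : Type} [Fintype V] (T : SimpleGraph V)
    (hT : T.IsTree) : bChromatic T = bRelaxed T := by
  have hle (s : Finset V) := BRelaxed.bChromatic_induce_le hT.isAcyclic (↑s : Set V)
  refine le_antisymm (le_csSup ⟨bChromatic T, ?_⟩ ⟨Finset.univ, ?_⟩)
    (csSup_le ⟨_, ∅, rfl⟩ ?_)
  · rintro _ ⟨s, rfl⟩
    exact hle s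
  · refine BRelaxed.bChromatic_congr ?_
    rw [Finset.coe_univ]
    exact T.induceUnivIso
  · rintro _ ⟨s, rfl⟩
    exact hle s
end
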